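/- arXiv:1901.05152 — 5 statements merged into one kernel-verified Lean document; each statement's English description precedes it below -/
import Mathlib

section
/- Under the pyramid timeout scheme, the per-level time allocations are non-increasing in the level at every step: for every step index k ∈ ℕ and every level l ∈ ℕ, it holds that n_l(k) ≥ n_{l+1}(k). -/
/-- Given the list `prev = [ℓ_0, …, ℓ_{k-1}]` of previously chosen timeout levels,
the pyramid timeout scheme selects the largest `L ∈ ℕ` such that
`n_l ≥ n_L + 2^L` for all `l < L`, where `n_l = (count of `l` in `prev`) · 2^l`.
(Every valid `L ≥ 1` satisfies `2^L ≤ n_0 ≤ prev.length`, hence `L ≤ prev.length`,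
so `Nat.findGreatest` with bound `prev.length` computes this largest `L`.) -/
def pyrNext (prev : List ℕ) : ℕ :=
  Nat.findGreatest
    (fun L => ∀ l < L, prev.count l * 2 ^ l ≥ prev.count L * 2 ^ L + 2 ^ L)
    prev.length

/-- `pyrSeq k = [ℓ_0, …, ℓ_{k-1}]`, the first `k` timeout levels of the pyramid scheme. -/
def pyrSeq : ℕ → List ℕ
  | 0 => []
  | k + 1 => pyrSeq k ++ [pyrNext (pyrSeq k)]

/-- `ℓ_k`, the timeout level selected at step `k`. -/
def pyrLevel (k : ℕ) : ℕ := pyrNext (pyrSeq k)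

/-- `n_l(k)`, the total execution time allocated to level `l` during the first `k` steps. -/
def pyrAlloc (l k : ℕ) : ℕ := (pyrSeq k).count l * 2 ^ l

/-- The level chosen by the pyramid scheme satisfies the selection condition. -/
theorem pyrNext_spec (prev : List ℕ) (l : ℕ) (hl : l < pyrNext prev) :
    prev.count (pyrNext prev) * 2 ^ pyrNext prev + 2 ^ pyrNext prev ≤ prev.count l * 2 ^ l :=
  Nat.findGreatest_spec
    (P := fun L => ∀ l < L, prev.count l * 2 ^ l ≥ prev.count L * 2 ^ L + 2 ^ L)
    (Nat.zero_le prev.length) (fun _ h => absurd h (Nat.not_lt_zero _)) l hl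

theorem pyrAlloc_succ (l k : ℕ) :
    pyrAlloc l (k + 1) = pyrAlloc l k + if pyrLevel k = l then 2 ^ l else 0 := by
  by_cases h : pyrNext (pyrSeq k) = l <;>
    simp [pyrAlloc, pyrSeq, pyrLevel, List.count_append, h, add_mul]

/-- Under the pyramid timeout scheme, per-level time allocations are non-increasing
in the level at every step: `n_l(k) ≥ n_{l+1}(k)` for all `k` and `l`. -/
theorem pyramid_alloc_antitone :
    ∀ k l : ℕ, pyrAlloc l k ≥ pyrAlloc (l + 1) k := by
  intro k
  induction k with
  | zero => simp [pyrAlloc, pyrSeq]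
  | succ k ih =>
    intro l
    rw [pyrAlloc_succ, pyrAlloc_succ]
    by_cases h : pyrLevel k = l + 1
    · have hs : pyrAlloc (pyrLevel k) k + 2 ^ pyrLevel k ≤ pyrAlloc l k :=
        pyrNext_spec (pyrSeq k) l (h.symm ▸ Nat.lt_succ_self l : l < pyrLevel k)
      rw [h] at hs
      rw [if_pos h]
      exact hs.trans (Nat.le_add_right _ _)
    · rw [if_neg h]
      exact (ih l).trans (Nat.le_add_right _ _)
end

section
/- Under the pyramid timeout scheme, the total amounts of execution time allocated to different already-used timeout levels cannot differ by more than a factor of two: for every step index k ∈ ℕ and all levels l₁, l₂ ∈ ℕ that are used during the first k steps, it holds that n_{l₁}(k) ≤ 2 · n_{l₂}(k). -/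
/-- A level `l` is 'used' during the first `k` steps if `ℓ_j = l` for some `j < k`. -/
def pyrUsed (l k : ℕ) : Prop := ∃ j < k, pyrLevel j = l

theorem pyrNext_eligible (s : List ℕ) :
    ∀ l < pyrNext s, s.count (pyrNext s) * 2 ^ pyrNext s + 2 ^ pyrNext s ≤ s.count l * 2 ^ l :=
  Nat.findGreatest_spec
    (P := fun L => ∀ l < L, s.count l * 2 ^ l ≥ s.count L * 2 ^ L + 2 ^ L)
    (Nat.zero_le _) (fun _ h => absurd h (Nat.not_lt_zero _))

theorem le_pyrNext_of_eligible (s : List ℕ) (L : ℕ)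
    (h : ∀ l < L, s.count L * 2 ^ L + 2 ^ L ≤ s.count l * 2 ^ l) : L ≤ pyrNext s := by
  refine Nat.le_findGreatest ?_ h
  rcases Nat.eq_zero_or_pos L with rfl | hL
  · exact Nat.zero_le _
  · have h0 := h 0 hL
    have hc : s.count 0 ≤ s.length := List.count_le_length
    have hp : L < 2 ^ L := Nat.lt_two_pow_self
    simp only [pow_zero, mul_one] at h0
    omega

theorem pyrAlloc_zero_right (l : ℕ) : pyrAlloc l 0 = 0 := by
  simp [pyrAlloc, pyrSeq]

theorem pyrAlloc_succ_self (k : ℕ) :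
    pyrAlloc (pyrLevel k) (k + 1) = pyrAlloc (pyrLevel k) k + 2 ^ pyrLevel k := by
  simp [pyrAlloc, pyrSeq, pyrLevel, add_mul]

theorem pyrAlloc_succ_of_ne {l k : ℕ} (h : l ≠ pyrLevel k) :
    pyrAlloc l (k + 1) = pyrAlloc l k := by
  have h' : pyrNext (pyrSeq k) ≠ l := fun e => h e.symm
  simp [pyrAlloc, pyrSeq, h']

theorem pyrAlloc_le_succ (l k : ℕ) : pyrAlloc l k ≤ pyrAlloc l (k + 1) := by
  by_cases h : l = pyrLevel k
  · subst h
    rw [pyrAlloc_succ_self]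
    exact Nat.le_add_right _ _
  · rw [pyrAlloc_succ_of_ne h]

theorem two_pow_dvd_pyrAlloc (l k : ℕ) : 2 ^ l ∣ pyrAlloc l k := Dvd.intro_left _ rfl

theorem pyrLevel_eligible {l k : ℕ} (h : l < pyrLevel k) :
    pyrAlloc (pyrLevel k) k + 2 ^ pyrLevel k ≤ pyrAlloc l k :=
  pyrNext_eligible (pyrSeq k) l h

theorem le_pyrLevel_of_eligible {L k : ℕ}
    (h : ∀ l < L, pyrAlloc L k + 2 ^ L ≤ pyrAlloc l k) : L ≤ pyrLevel k :=
  le_pyrNext_of_eligible (pyrSeq k) L h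

theorem add_le_of_dvd_of_lt {d a b : ℕ} (ha : d ∣ a) (hb : d ∣ b) (h : a < b) : a + d ≤ b := by
  have := Nat.le_of_dvd (Nat.sub_pos_of_lt h) (Nat.dvd_sub hb ha)
  omega

theorem pyrAlloc_antitone (k : ℕ) : Antitone fun l => pyrAlloc l k := by
  induction k with
  | zero => intro l m _; simp [pyrAlloc_zero_right]
  | succ k ih =>
    intro l m hlm
    dsimp only
    rcases hlm.eq_or_lt with rfl | hlt
    · exact le_rfl
    · by_cases hm : m = pyrLevel k
      · subst hm
        rw [pyrAlloc_succ_self]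
        exact (pyrLevel_eligible hlt).trans (pyrAlloc_le_succ l k)
      · rw [pyrAlloc_succ_of_ne hm]
        exact (ih hlm).trans (pyrAlloc_le_succ l k)

/-- If the level selected next is below `m`, then its allocation exceeds that of `m` by less
than `2 ^ m`. -/
theorem pyrAlloc_pyrLevel_lt {k m : ℕ} (hm : pyrLevel k < m) :
    pyrAlloc (pyrLevel k) k < pyrAlloc m k + 2 ^ m := by
  by_contra! hge
  have hex : ∃ l, l < m ∧ pyrAlloc l k < pyrAlloc m k + 2 ^ m := by
    by_contra! hno
    exact absurd (le_pyrLevel_of_eligible hno) (not_le.mpr hm)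
  obtain ⟨hlt, hlow⟩ := Nat.find_spec hex
  set p := Nat.find hex
  have hdvd : 2 ^ p ∣ pyrAlloc m k + 2 ^ m :=
    (pow_dvd_pow 2 hlt.le).trans
      (dvd_add (two_pow_dvd_pyrAlloc m k) dvd_rfl)
  have hstep := add_le_of_dvd_of_lt (two_pow_dvd_pyrAlloc p k) hdvd hlow
  have helig : p ≤ pyrLevel k := by
    refine le_pyrLevel_of_eligible fun l hl => hstep.trans ?_
    by_contra! hc
    exact Nat.find_min hex hl ⟨hl.trans hlt, hc⟩
  have := pyrAlloc_antitone k helig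
  dsimp only at this
  omega

theorem pyrAlloc_le_add_two_pow (k : ℕ) :
    ∀ l m, l < m → pyrAlloc l k ≤ pyrAlloc m k + 2 ^ m := by
  induction k with
  | zero => intro l m _; simp [pyrAlloc_zero_right]
  | succ k ih =>
    intro l m hlm
    have hmono := pyrAlloc_le_succ m k
    by_cases hl : l = pyrLevel k
    · subst hl
      rw [pyrAlloc_succ_self]
      have hlt := pyrAlloc_pyrLevel_lt hlm
      have hdvd : 2 ^ pyrLevel k ∣ pyrAlloc m k + 2 ^ m :=
        (pow_dvd_pow 2 hlm.le).trans (dvd_add (two_pow_dvd_pyrAlloc m k) dvd_rfl)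
      have := add_le_of_dvd_of_lt (two_pow_dvd_pyrAlloc _ k) hdvd hlt
      omega
    · rw [pyrAlloc_succ_of_ne hl]
      have := ih l m hlm
      omega

theorem two_pow_le_pyrAlloc_of_pyrUsed {l k : ℕ} (h : pyrUsed l k) : 2 ^ l ≤ pyrAlloc l k := by
  obtain ⟨j, hj, rfl⟩ := h
  have hmono : Monotone (pyrAlloc (pyrLevel j)) := monotone_nat_of_le_succ (pyrAlloc_le_succ _)
  calc 2 ^ pyrLevel j ≤ pyrAlloc (pyrLevel j) (j + 1) := by
        rw [pyrAlloc_succ_self]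
        exact Nat.le_add_left _ _
    _ ≤ pyrAlloc (pyrLevel j) k := hmono hj

/-- Under the pyramid timeout scheme, the total amounts of execution time allocated to
different already-used timeout levels cannot differ by more than a factor of two:
for all used levels `l₁, l₂`, we have `n_{l₁}(k) ≤ 2 · n_{l₂}(k)`. -/
theorem pyramid_alloc_balanced :
    ∀ k l₁ l₂ : ℕ, pyrUsed l₁ k → pyrUsed l₂ k →
      pyrAlloc l₁ k ≤ 2 * pyrAlloc l₂ k := by
  intro k l₁ l₂ _ h₂
  have hpow := two_pow_le_pyrAlloc_of_pyrUsed h₂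
  rcases lt_or_ge l₁ l₂ with hlt | hge
  · have := pyrAlloc_le_add_two_pow k l₁ l₂ hlt
    omega
  · have : pyrAlloc l₁ k ≤ pyrAlloc l₂ k := pyrAlloc_antitone k hge
    omega
end

section
/- Under the pyramid timeout scheme, the number of timeout levels used is upper-bounded by the binary logarithm of the total execution time: for every step index k ∈ ℕ with total execution time N(k) ≥ 2, the number of distinct levels used during the first k steps is at most log₂(N(k)). -/
/-- `N(k) = Σ_{j<k} 2^{ℓ_j}`, the total execution time after `k` steps. -/
def pyrTotal (k : ℕ) : ℕ := ∑ j ∈ Finset.range k, 2 ^ pyrLevel j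

theorem length_pyrSeq (k : ℕ) : (pyrSeq k).length = k := by
  induction k with
  | zero => rfl
  | succ k ih => simp [pyrSeq, ih]

/-- A positive level `L` is selected at step `j` only if level `0` was used at least `2 ^ L` times
before. -/
theorem two_pow_pyrLevel_le {j : ℕ} (h : pyrLevel j ≠ 0) : 2 ^ pyrLevel j ≤ j := by
  have hsel := Nat.findGreatest_of_ne_zero (m := pyrLevel j) rfl h 0 (Nat.pos_of_ne_zero h)
  have hcount := List.count_le_length (a := 0) (l := pyrSeq j)
  rw [length_pyrSeq] at hcount
  simp only [pow_zero, mul_one] at hsel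
  omega

theorem le_pyrTotal (k : ℕ) : k ≤ pyrTotal k := by
  simpa [pyrTotal] using
    Finset.card_nsmul_le_sum (Finset.range k) (fun j => 2 ^ pyrLevel j) 1
      fun j _ => Nat.one_le_two_pow

theorem pyrTotal_mono : Monotone pyrTotal :=
  monotone_nat_of_le_succ fun k => by simp [pyrTotal, Finset.sum_range_succ]

theorem two_pow_pyrLevel_succ_le_pyrTotal {j k : ℕ} (hjk : j < k) (hk : 2 ≤ pyrTotal k) :
    2 ^ (pyrLevel j + 1) ≤ pyrTotal k := by
  by_cases h : pyrLevel j = 0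
  · simpa [h] using hk
  · have hmono : pyrTotal (j + 1) ≤ pyrTotal k := pyrTotal_mono hjk
    have hsucc : pyrTotal (j + 1) = pyrTotal j + 2 ^ pyrLevel j := Finset.sum_range_succ _ _
    have hlevel := two_pow_pyrLevel_le h
    have htotal := le_pyrTotal j
    rw [pow_succ]
    omega

/-- Under the pyramid timeout scheme, the number of distinct timeout levels used during
the first `k` steps is at most `log₂(N(k))`, whenever the total execution time
`N(k)` is at least `2`. -/
theorem pyramid_nrLevels_le_log :
    ∀ k : ℕ, 2 ≤ pyrTotal k →
      ((Finset.image pyrLevel (Finset.range k)).card : ℝ) ≤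
        Real.logb 2 (pyrTotal k) := by
  intro k hk
  have hsub : Finset.image pyrLevel (Finset.range k) ⊆ Finset.range (Nat.log 2 (pyrTotal k)) := by
    intro l hl
    obtain ⟨j, hj, rfl⟩ := Finset.mem_image.mp hl
    exact Finset.mem_range.mpr <| Nat.le_log_of_pow_le one_lt_two <|
      two_pow_pyrLevel_succ_le_pyrTotal (Finset.mem_range.mp hj) hk
  have hcard := Finset.card_le_card hsub
  rw [Finset.card_range] at hcard
  exact (Nat.cast_le.mpr hcard).trans (by exact_mod_cast Real.natLog_le_logb (pyrTotal k) 2)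
end

section
/- Let m ≥ 1, c ≥ 0 and n ≥ 2 be real numbers, and let n₀, …, n_L be positive real numbers with n₀ + ⋯ + n_L = n, L + 1 ≤ log₂(n), and n_i ≤ 2 · n_j for all indices i, j. Fix an index l* ≤ L and suppose n* is a real number with n* ≥ (n_{l*} − c · log₂(n)) / (2m). Then n − n* ≤ (1 − 1/(4 · m · log₂(n))) · n + (c/(2m)) · log₂(n). -/
/-- Quantitative core of the regret bound for Skinner-G: total execution time `n ≥ 2`
is split among `L + 1 ≤ log₂ n` timeout levels as `n = n₀ + ⋯ + n_L`, allocations to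
different levels differ by at most factor two, and the optimal execution time `n*`
satisfies `n* ≥ (n_{l*} − c · log₂ n) / (2m)` for some fixed level `l*`. Then the
regret `n − n*` is at most `(1 − 1/(4 · m · log₂ n)) · n + (c/(2m)) · log₂ n`. -/
theorem skinnerG_regret_core (m c n : ℝ) (hm : 1 ≤ m) (hc : 0 ≤ c) (hn : 2 ≤ n)
    (L : ℕ) (nn : Fin (L + 1) → ℝ) (hpos : ∀ i, 0 < nn i)
    (hsum : ∑ i, nn i = n)
    (hL : (L + 1 : ℝ) ≤ Real.logb 2 n)
    (hbal : ∀ i j, nn i ≤ 2 * nn j)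
    (lstar : Fin (L + 1)) (nstar : ℝ)
    (hstar : nstar ≥ (nn lstar - c * Real.logb 2 n) / (2 * m)) :
    n - nstar ≤ (1 - 1 / (4 * m * Real.logb 2 n)) * n
      + (c / (2 * m)) * Real.logb 2 n := by
  have hlog : 0 < Real.logb 2 n := lt_of_lt_of_le (by positivity) hL
  have htotal : n ≤ Real.logb 2 n * (2 * nn lstar) := by
    calc n = ∑ i, nn i := hsum.symm
      _ ≤ ∑ _i : Fin (L + 1), 2 * nn lstar := Finset.sum_le_sum fun i _ => hbal i lstar
      _ = (L + 1 : ℝ) * (2 * nn lstar) := by simp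
      _ ≤ Real.logb 2 n * (2 * nn lstar) :=
        mul_le_mul_of_nonneg_right hL (by linarith [hpos lstar])
  generalize Real.logb 2 n = l at *
  have hm' : 0 < m := by linarith
  have hlevel : n / (4 * m * l) ≤ nn lstar / (2 * m) := by
    rw [div_le_div_iff₀ (by positivity) (by positivity)]
    nlinarith [mul_le_mul_of_nonneg_left htotal hm'.le]
  have hsplit : (nn lstar - c * l) / (2 * m) = nn lstar / (2 * m) - c / (2 * m) * l := by ring
  have hexpand : (1 - 1 / (4 * m * l)) * n = n - n / (4 * m * l) := by ring
  linarith
end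

section
/- For every natural number n* ≥ 1, letting L be the least natural number with n* ≤ 2^L and setting n = 2 · (2^L − 1) + n*, the regret satisfies n − n* ≤ (4/5) · n. -/
/-- If `L` is the least exponent with `m ≤ 2 ^ L`, then `2 ^ L` exceeds `2 * m` by at most one. -/
lemma two_pow_sub_one_le_two_mul_of_isLeast {m L : ℕ}
    (hL : IsLeast {L : ℕ | m ≤ 2 ^ L} L) : 2 ^ L - 1 ≤ 2 * m := by
  cases L with
  | zero => simp
  | succ k =>
    have hk : ¬ m ≤ 2 ^ k := fun hm => absurd (hL.2 hm) (by omega)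
    rw [pow_succ]
    omega

/-- Core of the regret bound of Skinner-H versus traditional execution: for `n* ≥ 1`,
with `L` the least natural number such that `n* ≤ 2^L`, and total execution time
`n = 2 · (2^L − 1) + n*`, the regret satisfies `n − n* ≤ (4/5) · n`. -/
theorem skinnerH_regret_vs_traditional (nstar L : ℕ) (h : 1 ≤ nstar)
    (hL : IsLeast {L : ℕ | nstar ≤ 2 ^ L} L) :
    ((2 * (2 ^ L - 1) + nstar : ℕ) : ℝ) - nstar ≤
      (4 / 5) * ((2 * (2 ^ L - 1) + nstar : ℕ) : ℝ) := by
  have hbound : ((2 ^ L - 1 : ℕ) : ℝ) ≤ 2 * nstar := by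
    exact_mod_cast two_pow_sub_one_le_two_mul_of_isLeast hL
  rw [Nat.cast_add, Nat.cast_mul, Nat.cast_ofNat]
  linarith
end
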